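/- Every Dieudonné K-module (N, φ) over k is isomorphic to a finite direct sum ⊕_{j=1}^m N_{r_j, s_j} for some m ≥ 0 and some pairs of integers (r_j, s_j) with r_j ≥ 1 and gcd(r_j, s_j) = 1, i.e. there is a 𝒦-linear bijection N → ⊕_{j=1}^m 𝒦^{r_j} intertwining φ with ⊕_j φ_{r_j, s_j}. -/

import Mathlib

/- STATEMENT 4: Every Dieudonné K-module (N, φ) over k is isomorphic to a finite direct sum
⊕_{j=1}^m N_{r_j, s_j} with r_j ≥ 1 and gcd(r_j, s_j) = 1: there is a 𝒦-linear bijection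
N → ⊕_j 𝒦^{r_j} intertwining φ with ⊕_j φ_{r_j,s_j}. -/

noncomputable section

set_option maxHeartbeats 1000000
set_option synthInstance.maxHeartbeats 1000000

/-- The uniformizer `π` of `k⟦π⟧`, viewed inside the Laurent series field `𝒦 = k⸨π⸩`. -/
def piL (k : Type*) [Field k] : LaurentSeries k := HahnSeries.single (1 : ℤ) (1 : k)

/-- The `σ`-semilinear map `φ_{r,s}` on `𝒦^r`, given by
`φ_{r,s}(a₀, …, a_{r-1}) = (π^s · σ(a_{r-1}), σ(a₀), …, σ(a_{r-2}))`. -/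
def phiRS {k : Type*} [Field k] (σ : LaurentSeries k ≃+* LaurentSeries k) (r : ℕ) (s : ℤ)
    (a : Fin r → LaurentSeries k) : Fin r → LaurentSeries k := fun i =>
  if _h : (i : ℕ) = 0 then piL k ^ s * σ (a ⟨r - 1, by have := i.isLt; omega⟩)
  else σ (a ⟨(i : ℕ) - 1, by have := i.isLt; omega⟩)

namespace DM

open Polynomial in
/-- Roots of the additive-type polynomial governing the recursion. -/
theorem exists_root_aux {k : Type*} [Field k] [IsAlgClosed k] (q : ℕ) (hq : 2 ≤ q) (m : ℕ)
    (c : ℕ → k) (hc : ∃ i < m, c i ≠ 0) (C0 : k) :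
    ∃ x : k, x = (∑ i ∈ Finset.range m, c i * x ^ (q ^ (m - i))) + C0 ∧ (C0 = 0 → x ≠ 0) := by
  obtain ⟨i0, hi0, hci0⟩ := hc
  have hE : ∀ i, i < m → 2 ≤ q ^ (m - i) := fun i hi =>
    hq.trans (Nat.le_self_pow (by omega) q)
  have hinj : ∀ i, i < m → q ^ (m - i) = q ^ (m - i0) → i = i0 := by
    intro i hi h
    have := Nat.pow_right_injective hq h
    omega
  by_cases h0 : C0 = 0
  · subst h0
    let P : k[X] := (∑ i ∈ Finset.range m, C (c i) * X ^ (q ^ (m - i) - 1)) - C 1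
    have hcoef : P.coeff (q ^ (m - i0) - 1) = c i0 := by
      have h2 := hE i0 hi0
      simp only [P, coeff_sub, finsetSum_coeff, coeff_C_mul, coeff_X_pow, coeff_C]
      rw [Finset.sum_eq_single i0]
      · simp; omega
      · intro b hb hne
        have hb' := Finset.mem_range.1 hb
        have := hE b hb'
        rw [if_neg, mul_zero]
        intro h
        exact hne (hinj b hb' (by omega))
      · intro h; exact absurd (Finset.mem_range.2 hi0) h
    have hdeg : P.degree ≠ 0 := by
      intro h
      have h1 := coeff_eq_zero_of_degree_lt (p := P) (n := q ^ (m - i0) - 1) (by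
        rw [h]; have := hE i0 hi0; exact_mod_cast (by omega : 0 < q ^ (m - i0) - 1))
      exact hci0 (hcoef ▸ h1)
    obtain ⟨x, hx⟩ := IsAlgClosed.exists_root P hdeg
    have hx' : (∑ i ∈ Finset.range m, c i * x ^ (q ^ (m - i) - 1)) = 1 := by
      have : P.eval x = 0 := hx
      simpa [P, eval_finsetSum, sub_eq_zero] using this
    refine ⟨x, ?_, ?_⟩
    · rw [add_zero]
      calc x = (∑ i ∈ Finset.range m, c i * x ^ (q ^ (m - i) - 1)) * x := by rw [hx', one_mul]
        _ = _ := by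
          rw [Finset.sum_mul]
          refine Finset.sum_congr rfl fun i hi => ?_
          have := hE i (Finset.mem_range.1 hi)
          rw [mul_assoc, ← pow_succ]
          congr 2; omega
    · rintro - rfl
      rw [Finset.sum_eq_zero] at hx'
      · exact zero_ne_one hx'
      · intro i hi
        have := hE i (Finset.mem_range.1 hi)
        rw [zero_pow (by omega), mul_zero]
  · let P : k[X] := (∑ i ∈ Finset.range m, C (c i) * X ^ (q ^ (m - i))) - X + C C0
    have hcoef : P.coeff (q ^ (m - i0)) = c i0 := by
      have h2 := hE i0 hi0
      simp only [P, coeff_sub, coeff_add, finsetSum_coeff, coeff_C_mul, coeff_X_pow, coeff_C,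
        coeff_X]
      rw [Finset.sum_eq_single i0]
      · rw [if_pos rfl, if_neg (by omega), if_neg (by omega)]; simp
      · intro b hb hne
        have hb' := Finset.mem_range.1 hb
        rw [if_neg, mul_zero]
        intro h
        exact hne (hinj b hb' h.symm)
      · intro h; exact absurd (Finset.mem_range.2 hi0) h
    have hdeg : P.degree ≠ 0 := by
      intro h
      have h1 := coeff_eq_zero_of_degree_lt (p := P) (n := q ^ (m - i0)) (by
        rw [h]; have := hE i0 hi0; exact_mod_cast (by omega : 0 < q ^ (m - i0)))
      exact hci0 (hcoef ▸ h1)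
    obtain ⟨x, hx⟩ := IsAlgClosed.exists_root P hdeg
    refine ⟨x, ?_, fun h => absurd h h0⟩
    have : P.eval x = 0 := hx
    simp only [P, eval_add, eval_sub, eval_finsetSum, eval_mul, eval_C, eval_pow, eval_X] at this
    linear_combination -this

/-- Strong recursion. -/
def recN {k : Type*} (H : (n : ℕ) → (Fin n → k) → k) : ℕ → k
  | n => H n (fun v => recN H v)
termination_by n => n
decreasing_by exact v.2

theorem exists_series {k : Type*} [Field k] [IsAlgClosed k] (q : ℕ) (hq : 2 ≤ q) (m : ℕ)
    (c : ℕ → ℕ → k) (hc : ∃ i < m, c i 0 ≠ 0) :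
    ∃ y : ℕ → k, y 0 ≠ 0 ∧ ∀ n, y n = ∑ i ∈ Finset.range m, ∑ v ∈ Finset.range (n + 1),
      c i (n - v) * y v ^ (q ^ (m - i)) := by
  choose ρ hρ hρ0 using exists_root_aux q hq m (fun i => c i 0) hc
  let H : (n : ℕ) → (Fin n → k) → k := fun n g =>
    ρ (∑ i ∈ Finset.range m, ∑ v : Fin n, c i (n - v) * g v ^ (q ^ (m - i)))
  have hy : ∀ n, recN H n = ρ (∑ i ∈ Finset.range m, ∑ v ∈ Finset.range n,
      c i (n - v) * recN H v ^ (q ^ (m - i))) := by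
    intro n
    rw [recN]
    simp only [H]
    congr 1
    refine Finset.sum_congr rfl fun i _ => ?_
    rw [Finset.sum_range (fun v => c i (n - v) * recN H v ^ (q ^ (m - i)))]
  refine ⟨recN H, ?_, fun n => ?_⟩
  · rw [hy 0]
    exact hρ0 _ (by simp)
  · simp only [Finset.sum_range_succ _ n, Finset.sum_add_distrib, Nat.sub_self]
    rw [add_comm]
    have := hρ (∑ i ∈ Finset.range m, ∑ v ∈ Finset.range n,
      c i (n - v) * recN H v ^ (q ^ (m - i)))
    rw [← hy n] at this
    exact this

theorem exists_recZ {k : Type*} [Zero k] (G : ℤ → k → k) (d : ℕ) (hd : 0 < d) (B : ℤ) :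
    ∃ x : ℤ → k, (∀ i < B, x i = 0) ∧ ∀ i, B ≤ i → x i = G i (x (i - d)) := by
  let H : (n : ℕ) → (Fin n → k) → k := fun n g =>
    G (n + B) (if h : d ≤ n then g ⟨n - d, by omega⟩ else 0)
  refine ⟨fun i => if i < B then 0 else recN H (i - B).toNat, fun i hi => if_pos hi,
    fun i hi => ?_⟩
  beta_reduce
  rw [if_neg (by omega), recN]
  simp only [H]
  have e1 : (((i - B).toNat : ℕ) : ℤ) + B = i := by omega
  rw [e1]
  congr 1
  by_cases h : d ≤ (i - B).toNat
  · rw [dif_pos h, if_neg (by omega)]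
    congr 1; omega
  · rw [dif_neg h, if_pos (by omega)]

theorem exists_laurent {k : Type*} [Field k] (x : ℤ → k) (B : ℤ) (h : ∀ i < B, x i = 0) :
    ∃ X : LaurentSeries k, ∀ i, X.coeff i = x i :=
  ⟨HahnSeries.ofSuppBddBelow x ⟨B, fun i hi => by
    by_contra hlt
    exact (Function.mem_support.1 hi) (h i (not_le.1 hlt))⟩, fun i => rfl⟩

theorem exists_lower {k : Type*} [Field k] (X : LaurentSeries k) :
    ∃ B : ℤ, ∀ i < B, X.coeff i = 0 :=
  ⟨X.order, fun _ hi => HahnSeries.coeff_eq_zero_of_lt_order hi⟩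

theorem piL_zpow {k : Type*} [Field k] (s : ℤ) :
    piL k ^ s = HahnSeries.single s (1 : k) := by
  exact (RatFunc.single_zpow s).symm

theorem coeff_piL_zpow_mul {k : Type*} [Field k] (s : ℤ) (x : LaurentSeries k) (n : ℤ) :
    (piL k ^ s * x).coeff n = x.coeff (n - s) := by
  have := HahnSeries.coeff_single_mul_add (r := (1 : k)) (x := x) (a := n - s) (b := s)
  rw [piL_zpow]
  simpa using this

theorem piL_ne {k : Type*} [Field k] : piL k ≠ 0 := by
  rw [piL]; exact HahnSeries.single_ne_zero one_ne_zero

section scal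

variable {k : Type*} [Field k] {q : ℕ}
  {σ : LaurentSeries k ≃+* LaurentSeries k}

theorem coeff_iter (hσ : ∀ (x : LaurentSeries k) (n : ℤ), (σ x).coeff n = x.coeff n ^ q)
    (j : ℕ) (x : LaurentSeries k) (n : ℤ) :
    (σ^[j] x).coeff n = x.coeff n ^ (q ^ j) := by
  induction j with
  | zero => simp
  | succ j ih => rw [Function.iterate_succ_apply', hσ, ih, ← pow_mul, pow_succ]

theorem sigma_piL (hq : 2 ≤ q)
    (hσ : ∀ (x : LaurentSeries k) (n : ℤ), (σ x).coeff n = x.coeff n ^ q)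
    (s : ℤ) : σ (piL k ^ s) = piL k ^ s := by
  ext n
  rw [hσ, piL_zpow, HahnSeries.coeff_single]
  split_ifs
  · simp
  · rw [zero_pow (by omega)]

theorem iter_piL (hq : 2 ≤ q)
    (hσ : ∀ (x : LaurentSeries k) (n : ℤ), (σ x).coeff n = x.coeff n ^ q)
    (j : ℕ) (s : ℤ) : σ^[j] (piL k ^ s) = piL k ^ s := by
  induction j with
  | zero => rfl
  | succ j ih => rw [Function.iterate_succ_apply', ih, sigma_piL hq hσ]

theorem sigma_order (hq : 2 ≤ q)
    (hσ : ∀ (x : LaurentSeries k) (n : ℤ), (σ x).coeff n = x.coeff n ^ q)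
    (x : LaurentSeries k) : (σ x).order = x.order := by
  by_cases hx : x = 0
  · simp [hx]
  · have hσx : σ x ≠ 0 := by simpa using hx
    apply le_antisymm
    · apply HahnSeries.order_le_of_coeff_ne_zero
      rw [hσ]
      exact pow_ne_zero _ (by simpa using hx)
    · apply HahnSeries.order_le_of_coeff_ne_zero
      have : (σ x).coeff (σ x).order ≠ 0 := by simpa using hσx
      rw [hσ] at this
      intro h
      rw [h, zero_pow (by omega)] at this
      exact this rfl

open Polynomial in
theorem scalar_surj (hq : 2 ≤ q)
    (hσ : ∀ (x : LaurentSeries k) (n : ℤ), (σ x).coeff n = x.coeff n ^ q)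
    [IsAlgClosed k] (n : ℕ) (hn : 1 ≤ n) (c : ℤ) (y : LaurentSeries k) :
    ∃ x : LaurentSeries k, σ^[n] x - piL k ^ c * x = y := by
  have hQ : 2 ≤ q ^ n := hq.trans (Nat.le_self_pow (by omega) q)
  suffices h : ∃ x : ℤ → k, (∃ B, ∀ i < B, x i = 0) ∧
      ∀ i, x i ^ (q ^ n) - x (i - c) = y.coeff i by
    obtain ⟨x, ⟨B, hB⟩, hx⟩ := h
    obtain ⟨X, hX⟩ := exists_laurent x B hB
    refine ⟨X, ?_⟩
    ext i
    rw [HahnSeries.coeff_sub, coeff_piL_zpow_mul, coeff_iter hσ, hX, hX, hx]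
  obtain ⟨B, hB⟩ := exists_lower y
  have hz : (0 : k) ^ (q ^ n) = 0 := zero_pow (by omega)
  rcases lt_trichotomy c 0 with hc | rfl | hc
  · obtain ⟨x, hx0, hx⟩ := exists_recZ (fun i t => t ^ (q ^ n) - y.coeff (i + c))
      (-c).toNat (by omega) (B - c)
    refine ⟨x, ⟨_, hx0⟩, fun i => ?_⟩
    by_cases hi : i < B
    · rw [hB i hi, hx0 i (by omega), hx0 (i - c) (by omega), hz, sub_zero]
    · rw [hx (i - c) (by omega)]
      have e1 : i - c - ((-c).toNat : ℤ) = i := by omega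
      have e2 : i - c + c = i := by omega
      rw [e1, e2]; ring
  · have hroot : ∀ t : k, ∃ x : k, x ^ (q ^ n) - x = t ∧ (t = 0 → x = 0) := by
      intro t
      by_cases ht : t = 0
      · exact ⟨0, by simp [ht, hz], fun _ => rfl⟩
      · obtain ⟨x, hx, -⟩ := exists_root_aux (k := k) (q ^ n) hQ 1 (fun _ => 1)
          ⟨0, by simp, one_ne_zero⟩ (-t)
        refine ⟨x, ?_, fun h => absurd h ht⟩
        simp at hx
        linear_combination -hx
    choose ρ h1 h2 using hroot
    refine ⟨fun i => ρ (y.coeff i), ⟨B, fun i hi => h2 _ (hB i hi)⟩, fun i => ?_⟩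
    rw [sub_zero]; exact h1 _
  · have hroot : ∀ t : k, ∃ x : k, x ^ (q ^ n) = t := fun t =>
      IsAlgClosed.exists_pow_nat_eq t (by omega)
    choose ρ hρ using hroot
    obtain ⟨x, hx0, hx⟩ := exists_recZ (fun i t => ρ (y.coeff i + t)) c.toNat (by omega) B
    refine ⟨x, ⟨_, hx0⟩, fun i => ?_⟩
    by_cases hi : i < B
    · rw [hB i hi, hx0 i (by omega), hx0 (i - c) (by omega), hz, sub_zero]
    · have e1 : i - (c.toNat : ℤ) = i - c := by omega
      rw [hx i (by omega), hρ, e1]; ring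

end scal

section modu

variable {k : Type*} [Field k] {q : ℕ}
  {σ : LaurentSeries k ≃+* LaurentSeries k}
  {N : Type*} [AddCommGroup N] [Module (LaurentSeries k) N]

theorem f_smul (f : N →ₛₗ[(σ : LaurentSeries k →+* LaurentSeries k)] N)
    (a : LaurentSeries k) (v : N) : f (a • v) = σ a • f v := by
  rw [map_smulₛₗ]; rfl

theorem iter_smul (f : N →ₛₗ[(σ : LaurentSeries k →+* LaurentSeries k)] N)
    (n : ℕ) (a : LaurentSeries k) (v : N) :
    f^[n] (a • v) = σ^[n] a • f^[n] v := by
  induction n with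
  | zero => rfl
  | succ n ih => simp only [Function.iterate_succ_apply', ih, f_smul]

theorem iter_add (f : N →ₛₗ[(σ : LaurentSeries k →+* LaurentSeries k)] N)
    (n : ℕ) (v w : N) : f^[n] (v + w) = f^[n] v + f^[n] w :=
  iterate_map_add f n v w

theorem iter_pi_smul (hq : 2 ≤ q)
    (hσ : ∀ (x : LaurentSeries k) (n : ℤ), (σ x).coeff n = x.coeff n ^ q)
    (f : N →ₛₗ[(σ : LaurentSeries k →+* LaurentSeries k)] N)
    (n : ℕ) (s : ℤ) (v : N) :
    f^[n] (piL k ^ s • v) = piL k ^ s • f^[n] v := by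
  rw [iter_smul, iter_piL hq hσ]

/-- iterating an eigen-relation -/
theorem iter_mul (hq : 2 ≤ q)
    (hσ : ∀ (x : LaurentSeries k) (n : ℤ), (σ x).coeff n = x.coeff n ^ q)
    (f : N →ₛₗ[(σ : LaurentSeries k →+* LaurentSeries k)] N)
    {r : ℕ} {s : ℤ} {u : N} (hu : f^[r] u = piL k ^ s • u) (a : ℕ) :
    f^[r * a] u = piL k ^ (s * a) • u := by
  induction a with
  | zero => simp
  | succ a ih =>
    rw [Nat.mul_succ, Function.iterate_add_apply, hu, iter_pi_smul hq hσ, ih, smul_smul,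
      ← zpow_add₀ piL_ne]
    congr 2; push_cast; ring

theorem line_surj (hq : 2 ≤ q)
    (hσ : ∀ (x : LaurentSeries k) (n : ℤ), (σ x).coeff n = x.coeff n ^ q)
    (f : N →ₛₗ[(σ : LaurentSeries k →+* LaurentSeries k)] N)
    [IsAlgClosed k] (a : ℕ) (ha : 1 ≤ a) (b : ℤ) {r : ℕ} (hr : 1 ≤ r) {s : ℤ} {u : N}
    (hu : f^[r] u = piL k ^ s • u) (y : LaurentSeries k) :
    ∃ x : LaurentSeries k, f^[a * r] (x • u) - piL k ^ (b * r) • (x • u) = y • u := by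
  obtain ⟨x, hx⟩ := scalar_surj hq hσ (a * r) (by nlinarith) (b * r - s * a)
    (piL k ^ (-(s * a)) * y)
  refine ⟨x, ?_⟩
  rw [iter_smul, mul_comm a r, iter_mul hq hσ f hu, smul_smul, smul_smul, ← sub_smul, mul_comm r a]
  congr 1
  have h1 : piL k ^ (b * r) = piL k ^ (s * a) * piL k ^ (b * r - s * a) := by
    rw [← zpow_add₀ piL_ne]; congr 1; ring
  have h2 : piL k ^ (s * a) * piL k ^ (-(s * a)) = 1 := by
    rw [← zpow_add₀ piL_ne]; simp
  rw [h1]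
  calc _ = piL k ^ (s * a) * (σ^[a * r] x - piL k ^ (b * r - s * a) * x) := by ring
    _ = _ := by rw [hx, ← mul_assoc, h2, one_mul]

/-- telescoping -/
theorem telescope (hq : 2 ≤ q)
    (hσ : ∀ (x : LaurentSeries k) (n : ℤ), (σ x).coeff n = x.coeff n ^ q)
    (f : N →ₛₗ[(σ : LaurentSeries k →+* LaurentSeries k)] N)
    (a : ℕ) (b : ℤ) (M : Submodule (LaurentSeries k) N)
    (hM : ∀ v ∈ M, f v ∈ M) (r : ℕ) (z : N) (hz : z ∈ M) :
    ∃ w ∈ M, f^[a] w - piL k ^ b • w = f^[a * r] z - piL k ^ (b * r) • z := by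
  have hMi : ∀ n, ∀ v ∈ M, f^[n] v ∈ M := by
    intro n
    induction n with
    | zero => exact fun v hv => hv
    | succ n ih => intro v hv; rw [Function.iterate_succ_apply']; exact hM _ (ih v hv)
  induction r with
  | zero => exact ⟨0, M.zero_mem, by simp⟩
  | succ r ih =>
    obtain ⟨w, hw, hw'⟩ := ih
    refine ⟨piL k ^ b • w + f^[a * r] z, M.add_mem (M.smul_mem _ hw) (hMi _ _ hz), ?_⟩
    have e1 : f^[a * (r + 1)] z = f^[a] (f^[a * r] z) := by
      rw [← Function.iterate_add_apply]; congr 2; ring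
    have e2 : piL k ^ (b * ((r + 1 : ℕ) : ℤ)) = piL k ^ b * piL k ^ (b * r) := by
      rw [← zpow_add₀ piL_ne]; congr 1; push_cast; ring
    rw [iter_add, iter_pi_smul hq hσ, e1, e2, mul_smul]
    have : piL k ^ b • f^[a] w = piL k ^ b • (f^[a * r] z - piL k ^ (b * r) • z)
        + piL k ^ b • (piL k ^ b • w) := by
      rw [← hw', smul_sub, sub_add_cancel]
    rw [this]
    simp only [smul_sub, smul_add]
    abel

theorem span_surj (hq : 2 ≤ q)
    (hσ : ∀ (x : LaurentSeries k) (n : ℤ), (σ x).coeff n = x.coeff n ^ q)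
    (f : N →ₛₗ[(σ : LaurentSeries k →+* LaurentSeries k)] N)
    [IsAlgClosed k] (S : Set N)
    (hS : ∀ u ∈ S, ∃ r : ℕ, 1 ≤ r ∧ ∃ s : ℤ, f^[r] u = piL k ^ s • u)
    (hM : ∀ v ∈ Submodule.span (LaurentSeries k) S, f v ∈ Submodule.span (LaurentSeries k) S)
    (a : ℕ) (ha : 1 ≤ a) (b : ℤ) (z : N) (hz : z ∈ Submodule.span (LaurentSeries k) S) :
    ∃ w ∈ Submodule.span (LaurentSeries k) S, f^[a] w - piL k ^ b • w = z := by
  rw [Submodule.mem_span_set'] at hz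
  obtain ⟨n, c, g, rfl⟩ := hz
  have key : ∀ i, ∃ w ∈ Submodule.span (LaurentSeries k) S,
      f^[a] w - piL k ^ b • w = c i • (g i : N) := by
    intro i
    obtain ⟨r, hr, s, hu⟩ := hS _ (g i).2
    obtain ⟨x, hx⟩ := line_surj hq hσ f a ha b hr hu (c i)
    obtain ⟨w, hw, hw'⟩ := telescope hq hσ f a b _ hM r (x • (g i : N))
      (Submodule.smul_mem _ _ (Submodule.subset_span (g i).2))
    exact ⟨w, hw, hw'.trans hx⟩
  choose w hw hw' using key
  refine ⟨∑ i, w i, Submodule.sum_mem _ fun i _ => hw i, ?_⟩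
  have : f^[a] (∑ i, w i) = ∑ i, f^[a] (w i) := by
    have := map_sum (AddMonoidHom.mk' (f^[a]) (iter_add f a)) w Finset.univ
    exact this
  rw [this, Finset.smul_sum, ← Finset.sum_sub_distrib]
  exact Finset.sum_congr rfl fun i _ => hw' i

theorem indep (hq : 2 ≤ q)
    (hσ : ∀ (x : LaurentSeries k) (n : ℤ), (σ x).coeff n = x.coeff n ^ q)
    (f : N →ₛₗ[(σ : LaurentSeries k →+* LaurentSeries k)] N)
    [FiniteDimensional (LaurentSeries k) N] {r : ℕ} (hr : 1 ≤ r) {s : ℤ}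
    (hrs : Int.gcd (r : ℤ) s = 1) {w : N} (hw : w ≠ 0) (hfw : f^[r] w = piL k ^ s • w) :
    LinearIndependent (LaurentSeries k) (fun i : Fin r => f^[(i : ℕ)] w) := by
  classical
  set g : Fin r → N := fun i => f^[(i : ℕ)] w with hg
  obtain ⟨b, hb, hspan, hli⟩ := exists_linearIndependent (LaurentSeries k) (Set.range g)
  have hbfin : b.Finite := (Set.finite_range g).subset hb
  have : Fintype b := hbfin.fintype
  have hfr : ∀ u ∈ b, f^[r] u = piL k ^ s • u := by
    intro u hu
    obtain ⟨i, rfl⟩ := hb hu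
    simp only [hg]
    rw [← Function.iterate_add_apply, add_comm, Function.iterate_add_apply, hfw,
      iter_pi_smul hq hσ]
  have hfb : ∀ u ∈ b, f u ∈ Submodule.span (LaurentSeries k) b := by
    intro u hu
    rw [hspan]
    obtain ⟨i, rfl⟩ := hb hu
    by_cases h : (i : ℕ) + 1 < r
    · apply Submodule.subset_span
      exact ⟨⟨i + 1, h⟩, by simp only [hg]; rw [Function.iterate_succ_apply']⟩
    · have : (i : ℕ) + 1 = r := by omega
      have e : f (g i) = piL k ^ s • g ⟨0, by omega⟩ := by
        simp only [hg]
        rw [← Function.iterate_succ_apply' f, Nat.succ_eq_add_one, this, hfw]; rfl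
      rw [e]
      exact Submodule.smul_mem _ _ (Submodule.subset_span ⟨_, rfl⟩)
  have hA : ∀ u : b, ∃ c : b → LaurentSeries k, ∑ v, c v • (v : N) = f u := by
    intro u
    have h : f u ∈ Submodule.span (LaurentSeries k) (Set.range (Subtype.val : b → N)) := by
      rw [Subtype.range_coe]; exact hfb u u.2
    rw [Submodule.mem_span_range_iff_exists_fun] at h
    exact h
  choose A0 hA0 using hA
  let A : Matrix b b (LaurentSeries k) := fun v u => A0 u v
  let An : ℕ → Matrix b b (LaurentSeries k) := fun n =>
    Nat.rec 1 (fun _ B => A * B.map σ) n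
  have hAn0 : An 0 = 1 := rfl
  have hAnS : ∀ n, An (n + 1) = A * (An n).map σ := fun n => rfl
  have hAn : ∀ n, ∀ u : b, f^[n] (u : N) = ∑ v : b, An n v u • (v : N) := by
    intro n
    induction n with
    | zero =>
      intro u
      rw [hAn0]
      simp [Matrix.one_apply]
    | succ n ih =>
      intro u
      rw [Function.iterate_succ_apply', ih, map_sum, hAnS]
      simp only [f_smul, ← hA0, Matrix.mul_apply, Matrix.map_apply, Finset.smul_sum,
        Finset.sum_smul, smul_smul]
      rw [Finset.sum_comm]
      refine Finset.sum_congr rfl fun v _ => Finset.sum_congr rfl fun v' _ => ?_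
      rw [mul_comm]
  have hAr : An r = Matrix.scalar b (piL k ^ s) := by
    ext1 v u
    have h1 := hAn r u
    rw [hfr u u.2] at h1
    have h2 : ∑ v : b, (An r v u - Matrix.scalar b (piL k ^ s) v u) • (v : N) = 0 := by
      simp only [sub_smul, Finset.sum_sub_distrib]
      rw [← h1, sub_eq_zero]
      simp [Matrix.diagonal_apply]
    have := Fintype.linearIndependent_iff.1 hli _ h2 v
    exact sub_eq_zero.1 this
  have hdet : ∀ n, (An (n + 1)).det = A.det * σ (An n).det := by
    intro n
    rw [hAnS, Matrix.det_mul]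
    congr 1
    exact ((σ : LaurentSeries k →+* LaurentSeries k).map_det (An n)).symm
  have hdr : (An r).det = piL k ^ (s * (Fintype.card b : ℤ)) := by
    rw [hAr, Matrix.scalar_apply, Matrix.det_diagonal, Finset.prod_const, Finset.card_univ,
      zpow_mul, zpow_natCast]
  have hdA : A.det ≠ 0 := by
    intro h
    obtain ⟨r', rfl⟩ : ∃ r', r = r' + 1 := ⟨r - 1, by omega⟩
    rw [hdet, h, zero_mul] at hdr
    exact zpow_ne_zero _ piL_ne hdr.symm
  have hord : ∀ n : ℕ, (An n).det ≠ 0 ∧ (An n).det.order = n * A.det.order := by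
    intro n
    induction n with
    | zero => rw [hAn0]; simp
    | succ n ih =>
      have hne : σ (An n).det ≠ 0 := by simpa using ih.1
      refine ⟨by rw [hdet]; exact mul_ne_zero hdA hne, ?_⟩
      rw [hdet, HahnSeries.order_mul hdA hne, sigma_order hq hσ, ih.2]
      push_cast; ring
  have heq : s * (Fintype.card b : ℤ) = r * A.det.order := by
    rw [← (hord r).2, hdr, piL_zpow, HahnSeries.order_single one_ne_zero]
  have hdvd : (r : ℤ) ∣ (Fintype.card b : ℤ) := by
    have h1 : (r : ℤ) ∣ s * (Fintype.card b : ℤ) := ⟨_, heq⟩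
    exact IsCoprime.dvd_of_dvd_mul_left (Int.isCoprime_iff_gcd_eq_one.2 hrs) h1
  have hcard : (Set.range g).finrank (LaurentSeries k) = Fintype.card b := by
    rw [Set.finrank, ← hspan]
    have := finrank_span_eq_card hli
    rwa [Subtype.range_coe] at this
  have hpos : 0 < Fintype.card b := by
    rw [Fintype.card_pos_iff]
    by_contra hempty
    rw [not_nonempty_iff, Set.isEmpty_coe_sort] at hempty
    have : w ∈ Submodule.span (LaurentSeries k) (Set.range g) :=
      Submodule.subset_span ⟨⟨0, by omega⟩, rfl⟩
    rw [← hspan, hempty] at this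
    simp at this
    exact hw this
  rw [linearIndependent_iff_card_eq_finrank_span, hcard, Fintype.card_fin]
  apply le_antisymm
  · exact Nat.le_of_dvd hpos (by exact_mod_cast hdvd)
  · rw [← hcard]
    simpa using finrank_range_le_card (R := LaurentSeries k) (b := g)

/-- A cyclic vector relation. -/
theorem exists_cyclic (f : N →ₛₗ[(σ : LaurentSeries k →+* LaurentSeries k)] N)
    [FiniteDimensional (LaurentSeries k) N] [Nontrivial N]
    (hf : Function.Injective f) :
    ∃ (v : N) (m : ℕ) (a : ℕ → LaurentSeries k),
      LinearIndependent (LaurentSeries k) (fun i : Fin m => f^[(i : ℕ)] v) ∧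
      f^[m] v = ∑ i ∈ Finset.range m, a i • f^[i] v ∧ ∃ i < m, a i ≠ 0 := by
  classical
  obtain ⟨v, hv⟩ := exists_ne (0 : N)
  let P : ℕ → Prop := fun m =>
    ¬ LinearIndependent (LaurentSeries k) (fun i : Fin (m + 1) => f^[(i : ℕ)] v)
  have hP : ∃ m, P m := by
    refine ⟨Module.finrank (LaurentSeries k) N, fun h => ?_⟩
    have := h.fintype_card_le_finrank
    simp at this
  let m := Nat.find hP
  have hm : P m := Nat.find_spec hP
  have hli : LinearIndependent (LaurentSeries k) (fun i : Fin m => f^[(i : ℕ)] v) := by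
    rcases Nat.eq_zero_or_pos m with h0 | h0
    · have : IsEmpty (Fin m) := by rw [h0]; infer_instance
      exact linearIndependent_empty_type
    · have h1 : ¬ P (m - 1) := Nat.find_min hP (by omega)
      have h2 : m - 1 + 1 = m := by omega
      simp only [P, not_not] at h1
      rw [h2] at h1
      exact h1
  have hmem : f^[m] v ∈ Submodule.span (LaurentSeries k)
      (Set.range (fun i : Fin m => f^[(i : ℕ)] v)) := by
    by_contra hnot
    apply hm
    have := linearIndependent_finSnoc.2 ⟨hli, hnot⟩
    have e : (fun i : Fin (m + 1) => f^[(i : ℕ)] v) =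
        (Fin.snoc (fun i : Fin m => f^[(i : ℕ)] v) (f^[m] v) : Fin (m + 1) → N) := by
      ext i
      refine Fin.lastCases ?_ (fun i => ?_) i
      · simp
      · simp
    rw [e]
    exact this
  rw [Submodule.mem_span_range_iff_exists_fun] at hmem
  obtain ⟨c, hc⟩ := hmem
  let a : ℕ → LaurentSeries k := fun i => if h : i < m then c ⟨i, h⟩ else 0
  have ha : f^[m] v = ∑ i ∈ Finset.range m, a i • f^[i] v := by
    rw [← hc, Finset.sum_range]
    refine Finset.sum_congr rfl fun i _ => ?_
    simp [a]
  refine ⟨v, m, a, hli, ha, ?_⟩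
  by_contra hno
  push Not at hno
  rw [Finset.sum_eq_zero] at ha
  · have hfi : Function.Injective (f^[m]) := hf.iterate m
    apply hv
    apply hfi
    rw [ha, iterate_map_zero f]
  · intro i hi
    rw [hno i (Finset.mem_range.1 hi), zero_smul]

theorem exists_slope (m : ℕ) (a : ℕ → LaurentSeries k) (ha : ∃ i < m, a i ≠ 0) :
    ∃ (r : ℕ) (s : ℤ), 1 ≤ r ∧ Int.gcd (r : ℤ) s = 1 ∧
      (∀ i < m, ∀ l, (a i).coeff l ≠ 0 → s * ((m - i : ℕ) : ℤ) ≤ r * l) ∧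
      ∃ i < m, ∃ l, (a i).coeff l ≠ 0 ∧ s * ((m - i : ℕ) : ℤ) = r * l := by
  classical
  have hne : ((Finset.range m).filter (fun i => a i ≠ 0)).Nonempty := by
    obtain ⟨i, hi, h⟩ := ha
    exact ⟨i, by simp [hi, h]⟩
  obtain ⟨i0, hi0, hmin⟩ := Finset.exists_min_image _
    (fun i => ((a i).order : ℚ) / ((m - i : ℕ) : ℚ)) hne
  simp only [Finset.mem_filter, Finset.mem_range] at hi0 hmin
  set D : ℕ := m - i0 with hD
  have hDpos : 0 < D := by omega
  set O : ℤ := (a i0).order with hO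
  have hgpos : 0 < Int.gcd (D : ℤ) O := Int.gcd_pos_of_ne_zero_left _ (by omega)
  obtain ⟨r', s, hcop, hr', hs⟩ := Int.exists_gcd_one hgpos
  set G : ℕ := Int.gcd (D : ℤ) O with hG
  have hGz : (0 : ℤ) < G := by exact_mod_cast hgpos
  have hr'pos : 0 < r' := by
    by_contra h
    have : r' * (G : ℤ) ≤ 0 := mul_nonpos_of_nonpos_of_nonneg (by omega) hGz.le
    omega
  have hrr : ((r'.toNat : ℕ) : ℤ) = r' := by omega
  refine ⟨r'.toNat, s, by omega, by rw [hrr]; exact hcop, ?_, i0, hi0.1, O, ?_, ?_⟩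
  · intro i hi l hl
    rw [hrr]
    have hai : a i ≠ 0 := by rintro h; simp [h] at hl
    have h1 := hmin i ⟨hi, hai⟩
    have hmi : (0 : ℚ) < ((m - i : ℕ) : ℚ) := by exact_mod_cast (by omega : 0 < m - i)
    have hDq : (0 : ℚ) < (D : ℚ) := by exact_mod_cast hDpos
    rw [div_le_div_iff₀ hDq hmi] at h1
    have h2 : O * ((m - i : ℕ) : ℤ) ≤ (a i).order * (D : ℤ) := by exact_mod_cast h1
    have h3 : (a i).order ≤ l := HahnSeries.order_le_of_coeff_ne_zero hl
    have h4 : s * ((m - i : ℕ) : ℤ) ≤ r' * (a i).order := by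
      rw [hr', hs] at h2
      by_contra hlt
      push Not at hlt
      have := mul_lt_mul_of_pos_right hlt hGz
      nlinarith
    calc _ ≤ _ := h4
      _ ≤ _ := mul_le_mul_of_nonneg_left h3 hr'pos.le
  · rw [hO, Ne, HahnSeries.coeff_order_eq_zero]; exact hi0.2
  · rw [hrr, ← hD]
    rw [hr', hs]; ring

theorem exists_Y (hq : 2 ≤ q)
    (hσ : ∀ (x : LaurentSeries k) (n : ℤ), (σ x).coeff n = x.coeff n ^ q)
    [IsAlgClosed k] (m : ℕ) (a : ℕ → LaurentSeries k) (r : ℕ) (s : ℤ) (hr : 1 ≤ r)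
    (hle : ∀ i < m, ∀ l, (a i).coeff l ≠ 0 → s * ((m - i : ℕ) : ℤ) ≤ r * l)
    (heq : ∃ i < m, ∃ l, (a i).coeff l ≠ 0 ∧ s * ((m - i : ℕ) : ℤ) = r * l) :
    ∃ Y : ℤ → LaurentSeries k, Y 0 ≠ 0 ∧ (∀ j t, Y (j - r * t) = piL k ^ t * Y j) ∧
      ∀ j, Y j = ∑ i ∈ Finset.range m,
        σ^[m - 1 - i] (a i) * σ^[m - i] (Y (j + s * ((m - i : ℕ) : ℤ))) := by
  classical
  have hrz : (0 : ℤ) < r := by exact_mod_cast hr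
  let c : ℕ → ℕ → k := fun i u =>
    if (r : ℤ) ∣ u + s * ((m - i : ℕ) : ℤ) then
      (σ^[m - 1 - i] (a i)).coeff ((u + s * ((m - i : ℕ) : ℤ)) / r) else 0
  have hq0 : ∀ j, q ^ j ≠ 0 := fun j => pow_ne_zero _ (by omega)
  obtain ⟨y, hy0, hy⟩ := exists_series q hq m c (by
    obtain ⟨i, hi, l, hl, h⟩ := heq
    refine ⟨i, hi, ?_⟩
    simp only [c, Nat.cast_zero, zero_add]
    rw [h, if_pos (dvd_mul_right _ _), Int.mul_ediv_cancel_left _ hrz.ne', coeff_iter hσ]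
    exact pow_ne_zero _ hl)
  let z : ℤ → k := fun n => if 0 ≤ n then y n.toNat else 0
  have hzneg : ∀ n < 0, z n = 0 := fun n hn => if_neg (by omega)
  have hznat : ∀ n : ℕ, z n = y n := fun n => by simp [z]
  have hYex : ∀ j : ℤ, ∃ Y : LaurentSeries k, ∀ n, Y.coeff n = z (r * n + j) := by
    intro j
    refine exists_laurent (fun n => z (r * n + j)) (-|j|) fun i hi => hzneg _ ?_
    have := neg_abs_le j
    have := le_abs_self j
    have := abs_nonneg j
    nlinarith
  choose Y hY using hYex
  refine ⟨Y, ?_, ?_, ?_⟩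
  · intro h
    have := hY 0 0
    rw [h] at this
    simp [z] at this
    exact hy0 this.symm
  · intro j t
    ext n
    rw [coeff_piL_zpow_mul, hY, hY]
    congr 1; ring
  · intro j
    ext n
    rw [HahnSeries.coeff_sum, hY]
    have hterm : ∀ i, ∀ l l' : ℤ, l + l' = n →
        (σ^[m - i] (Y (j + s * ((m - i : ℕ) : ℤ)))).coeff l' =
          z (r * n + j - (r * l - s * ((m - i : ℕ) : ℤ))) ^ (q ^ (m - i)) := by
      intro i l l' hl
      rw [coeff_iter hσ, hY]
      congr 2; rw [← hl]; ring
    have hpos : ∀ i < m, ∀ l, (σ^[m - 1 - i] (a i)).coeff l ≠ 0 →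
        0 ≤ r * l - s * ((m - i : ℕ) : ℤ) := by
      intro i hi l hl
      rw [coeff_iter hσ] at hl
      have := hle i hi l (fun h => hl (by rw [h, zero_pow (hq0 _)]))
      omega
    rcases lt_or_ge (r * n + j) 0 with hneg | hnn
    · rw [hzneg _ hneg, eq_comm]
      refine Finset.sum_eq_zero fun i hi => ?_
      rw [HahnSeries.coeff_mul]
      refine Finset.sum_eq_zero fun ij hij => ?_
      rw [Finset.mem_antidiagonal] at hij
      rw [hterm i _ _ hij.2.2, hzneg _ (by
        have := hpos i (Finset.mem_range.1 hi) ij.1 hij.1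
        omega), zero_pow (hq0 _), mul_zero]
    · obtain ⟨M, hM⟩ := Int.eq_ofNat_of_zero_le hnn
      rw [hM, hznat, hy]
      refine Finset.sum_congr rfl fun i hi => ?_
      have hi' := Finset.mem_range.1 hi
      rw [HahnSeries.coeff_mul]
      set E : ℤ := s * ((m - i : ℕ) : ℤ) with hE
      have hsupp : ∀ ij ∈ Finset.antidiagonal (σ^[m - 1 - i] (a i)).isPWO_support
          (σ^[m - i] (Y (j + E))).isPWO_support n,
          0 ≤ r * ij.1 - E ∧ r * ij.1 - E ≤ M := by
        intro ij hij
        rw [Finset.mem_antidiagonal] at hij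
        refine ⟨hpos i hi' _ hij.1, ?_⟩
        by_contra hlt
        have h2 := hij.2.1
        rw [HahnSeries.mem_support, hterm i _ _ hij.2.2, hzneg _ (by omega),
          zero_pow (hq0 _)] at h2
        exact h2 rfl
      symm
      refine Finset.sum_bij_ne_zero (fun ij _ _ => (M - (r * ij.1 - E)).toNat) ?_ ?_ ?_ ?_
      · intro ij hij _
        have := hsupp ij hij
        rw [Finset.mem_range]; omega
      · intro x hx _ x' hx' _ h
        have h1 := hsupp x hx
        have h2 := hsupp x' hx'
        have h3 : (r : ℤ) * x.1 = r * x'.1 := by omega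
        have h4 : x.1 = x'.1 := mul_left_cancel₀ hrz.ne' h3
        rw [Finset.mem_antidiagonal] at hx hx'
        ext
        · exact h4
        · have := hx.2.2; have := hx'.2.2; omega
      · intro v hv hne
        have hv' : v ≤ M := by have := Finset.mem_range.1 hv; omega
        have hcne : c i (M - v) ≠ 0 := left_ne_zero_of_mul hne
        have hyne : y v ^ (q ^ (m - i)) ≠ 0 := right_ne_zero_of_mul hne
        simp only [c] at hcne
        rw [← hE] at hcne
        split_ifs at hcne with hd
        · obtain ⟨l, hl⟩ := hd
          rw [hl, Int.mul_ediv_cancel_left _ hrz.ne'] at hcne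
          have hz2 := hterm i l (n - l) (by ring)
          rw [← hE] at hz2
          have e1 : r * n + j - (r * l - E) = (v : ℤ) := by
            push_cast [hv'] at hl; omega
          rw [e1, hznat] at hz2
          refine ⟨(l, n - l), ?_, ?_, ?_⟩
          · rw [Finset.mem_antidiagonal]
            refine ⟨hcne, ?_, by simp⟩
            rw [HahnSeries.mem_support, hz2]; exact hyne
          · simp only
            rw [hz2]; exact mul_ne_zero hcne hyne
          · simp only
            push_cast [hv'] at hl; omega
        · exact absurd rfl hcne
      · intro ij hij _
        have h1 := hsupp ij hij
        rw [Finset.mem_antidiagonal] at hij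
        have hz2 := hterm i ij.1 ij.2 hij.2.2
        rw [← hE] at hz2
        rw [hz2]
        have e2 : r * n + j - (r * ij.1 - E) = (((M - (r * ij.1 - E)).toNat : ℕ) : ℤ) := by omega
        rw [e2, hznat]
        congr 1
        simp only [c]
        rw [← hE]
        have e3 : ((M - (M - (r * ij.1 - E)).toNat : ℕ) : ℤ) + E = r * ij.1 := by omega
        rw [e3, if_pos (dvd_mul_right _ _), Int.mul_ediv_cancel_left _ hrz.ne']

theorem exists_eigen (hq : 2 ≤ q)
    (hσ : ∀ (x : LaurentSeries k) (n : ℤ), (σ x).coeff n = x.coeff n ^ q)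
    (f : N →ₛₗ[(σ : LaurentSeries k →+* LaurentSeries k)] N)
    [IsAlgClosed k] [FiniteDimensional (LaurentSeries k) N] [Nontrivial N]
    (hf : Function.Injective f) :
    ∃ (r : ℕ) (s : ℤ) (w : N), 1 ≤ r ∧ Int.gcd (r : ℤ) s = 1 ∧ w ≠ 0 ∧
      f^[r] w = piL k ^ s • w := by
  obtain ⟨v, m, a, hli, hrel, hane⟩ := exists_cyclic f hf
  obtain ⟨r, s, hr, hrs, hle, heq⟩ := exists_slope m a hane
  obtain ⟨Y, hY0, hYt, hY⟩ := exists_Y hq hσ m a r s hr hle heq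
  obtain ⟨m, rfl⟩ : ∃ m', m = m' + 1 := by
    obtain ⟨i, hi, -⟩ := hane
    exact ⟨m - 1, by omega⟩
  let x : ℕ → ℤ → LaurentSeries k := fun i j => ∑ h ∈ Finset.range (i + 1),
    σ^[i - h] (a h) * σ^[i + 1 - h] (Y (j + s * ((i + 1 - h : ℕ) : ℤ)))
  have hx0 : ∀ j, x 0 j = a 0 * σ (Y (j + s)) := by
    intro j; simp [x]
  have hxs : ∀ i j, x (i + 1) j = σ (x i (j + s)) + a (i + 1) * σ (Y (j + s)) := by
    intro i j
    simp only [x]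
    rw [Finset.sum_range_succ]
    congr 1
    · rw [map_sum]
      refine Finset.sum_congr rfl fun h hh => ?_
      have hh' := Finset.mem_range.1 hh
      have e1 : i + 1 - h = (i - h) + 1 := by omega
      have e2 : i + 1 + 1 - h = (i + 1 - h) + 1 := by omega
      rw [map_mul, ← Function.iterate_succ_apply' σ, ← Function.iterate_succ_apply' σ]
      rw [e2]
      nth_rewrite 1 [e1]
      have e3 : j + s * ((i + 1 - h + 1 : ℕ) : ℤ) = j + s + s * ((i + 1 - h : ℕ) : ℤ) := by
        push_cast; ring
      rw [e3]
    · simp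
  have hxm : ∀ j, x m j = Y j := by
    intro j
    rw [hY j]
    simp only [x]
    rfl
  have hxt : ∀ i j t, x i (j - r * t) = piL k ^ t * x i j := by
    intro i j t
    simp only [x]
    rw [Finset.mul_sum]
    refine Finset.sum_congr rfl fun h _ => ?_
    have e1 : j - r * t + s * ((i + 1 - h : ℕ) : ℤ) = (j + s * ((i + 1 - h : ℕ) : ℤ)) - r * t := by
      ring
    rw [e1, hYt, iterate_map_mul σ, iter_piL hq hσ]
    ring
  let w : ℤ → N := fun j => ∑ i ∈ Finset.range (m + 1), x i j • f^[i] v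
  have hw : ∀ j, f (w (j + s)) = w j := by
    intro j
    simp only [w]
    rw [map_sum, Finset.sum_range_succ, Finset.sum_range_succ']
    simp only [f_smul, ← Function.iterate_succ_apply' f, Nat.succ_eq_add_one]
    rw [hrel, hxm, Finset.sum_range_succ', hx0]
    simp only [hxs, add_smul, Finset.sum_add_distrib, smul_add, Finset.smul_sum, smul_smul,
      mul_comm (a _)]
    abel
  have hwn : ∀ n : ℕ, ∀ j, f^[n] (w (j + n * s)) = w j := by
    intro n
    induction n with
    | zero => intro j; simp
    | succ n ih =>
      intro j
      rw [Function.iterate_succ_apply', ← hw j, ← ih (j + s)]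
      congr 3; push_cast; ring
  have hwt : ∀ j t, w (j - r * t) = piL k ^ t • w j := by
    intro j t
    simp only [w, hxt, Finset.smul_sum, smul_smul]
  refine ⟨r, s, w 0, hr, hrs, ?_, ?_⟩
  · intro h
    have h' : ∑ i : Fin (m + 1), x i 0 • f^[(i : ℕ)] v = 0 := by
      rw [← Finset.sum_range (fun i => x i 0 • f^[i] v)]; exact h
    have := Fintype.linearIndependent_iff.1 hli _ h' (Fin.last m)
    simp only [Fin.val_last] at this
    rw [hxm] at this
    exact hY0 this
  · have h1 := hwn r (0 - r * s)
    rw [sub_add_cancel] at h1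
    rw [h1, hwt]

/-- Index set attached to a set of triples. -/
def J (N : Type*) (S : Finset (ℕ × ℤ × N)) : Set ((ℕ × ℤ × N) × ℕ) :=
  {p | p.1 ∈ S ∧ p.2 < p.1.1}

/-- The vector attached to an index. -/
def vec (f : N →ₛₗ[(σ : LaurentSeries k →+* LaurentSeries k)] N)
    (p : (ℕ × ℤ × N) × ℕ) : N := f^[p.2] p.1.2.2

/-- Good families of triples. -/
def Good (f : N →ₛₗ[(σ : LaurentSeries k →+* LaurentSeries k)] N)
    (S : Finset (ℕ × ℤ × N)) : Prop :=
  (∀ t ∈ S, 1 ≤ t.1 ∧ Int.gcd (t.1 : ℤ) t.2.1 = 1 ∧ f^[t.1] t.2.2 = piL k ^ t.2.1 • t.2.2) ∧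
  LinearIndepOn (LaurentSeries k) (vec f) (J N S)

theorem extend_good (hq : 2 ≤ q)
    (hσ : ∀ (x : LaurentSeries k) (n : ℤ), (σ x).coeff n = x.coeff n ^ q)
    (f : N →ₛₗ[(σ : LaurentSeries k →+* LaurentSeries k)] N)
    [IsAlgClosed k] [FiniteDimensional (LaurentSeries k) N]
    (hf : Function.Injective f)
    (S : Finset (ℕ × ℤ × N)) (hS : Good f S)
    (hne : Submodule.span (LaurentSeries k) (vec f '' J N S) ≠ ⊤) :
    ∃ S' : Finset (ℕ × ℤ × N), Good f S' ∧
      Submodule.span (LaurentSeries k) (vec f '' J N S) <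
        Submodule.span (LaurentSeries k) (vec f '' J N S') := by
  classical
  set M := Submodule.span (LaurentSeries k) (vec f '' J N S) with hMdef
  have heig : ∀ u ∈ vec f '' J N S, ∃ r : ℕ, 1 ≤ r ∧ ∃ s : ℤ, f^[r] u = piL k ^ s • u := by
    rintro _ ⟨p, hp, rfl⟩
    obtain ⟨h1, -, h2⟩ := hS.1 _ hp.1
    refine ⟨p.1.1, h1, p.1.2.1, ?_⟩
    rw [vec, ← Function.iterate_add_apply, add_comm, Function.iterate_add_apply, h2,
      iter_pi_smul hq hσ]
  have hMf : ∀ v ∈ M, f v ∈ M := by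
    intro v hv
    induction hv using Submodule.span_induction with
    | zero => rw [map_zero]; exact M.zero_mem
    | add x y _ _ hx hy => rw [map_add]; exact M.add_mem hx hy
    | smul a x _ hx => rw [f_smul]; exact M.smul_mem _ hx
    | mem x hx =>
      obtain ⟨⟨t, i⟩, ⟨ht, hi⟩, rfl⟩ := hx
      simp only at ht hi
      obtain ⟨h1, -, h2⟩ := hS.1 _ ht
      simp only [vec]
      rw [← Function.iterate_succ_apply' f]
      by_cases h : i + 1 < t.1
      · exact Submodule.subset_span ⟨(t, i + 1), ⟨ht, h⟩, rfl⟩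
      · have : i.succ = t.1 := by omega
        rw [this, h2]
        exact M.smul_mem _ (Submodule.subset_span ⟨(t, 0), ⟨ht, h1⟩, rfl⟩)
  have hMi : ∀ n, ∀ v ∈ M, f^[n] v ∈ M := by
    intro n
    induction n with
    | zero => exact fun v hv => hv
    | succ n ih => intro v hv; rw [Function.iterate_succ_apply']; exact hMf _ (ih v hv)
  have hMsurj : ∀ v ∈ M, ∃ x ∈ M, f x = v := by
    intro v hv
    induction hv using Submodule.span_induction with
    | zero => exact ⟨0, M.zero_mem, map_zero f⟩
    | add x y _ _ hx hy =>
      obtain ⟨x', hx', rfl⟩ := hx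
      obtain ⟨y', hy', rfl⟩ := hy
      exact ⟨x' + y', M.add_mem hx' hy', map_add f _ _⟩
    | smul a x _ hx =>
      obtain ⟨x', hx', rfl⟩ := hx
      exact ⟨σ.symm a • x', M.smul_mem _ hx', by rw [f_smul]; simp⟩
    | mem x hx =>
      have hxM : x ∈ M := Submodule.subset_span hx
      obtain ⟨r, hr, s, hrs⟩ := heig x hx
      refine ⟨piL k ^ (-s) • f^[r - 1] x, M.smul_mem _ (hMi _ _ hxM), ?_⟩
      have e : (r - 1).succ = r := by omega
      rw [f_smul, sigma_piL hq hσ, ← Function.iterate_succ_apply' f, e, hrs, smul_smul,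
        ← zpow_add₀ piL_ne]
      simp
  let g : (N ⧸ M) →ₛₗ[(σ : LaurentSeries k →+* LaurentSeries k)] (N ⧸ M) :=
    M.mapQ M f (fun v hv => hMf v hv)
  have hg : ∀ v : N, g (M.mkQ v) = M.mkQ (f v) := fun v => rfl
  have hgi : ∀ n, ∀ v : N, g^[n] (M.mkQ v) = M.mkQ (f^[n] v) := by
    intro n v
    induction n with
    | zero => rfl
    | succ n ih => rw [Function.iterate_succ_apply', Function.iterate_succ_apply', ih, hg]
  have hginj : Function.Injective g := by
    rw [injective_iff_map_eq_zero]
    intro x hx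
    obtain ⟨v, rfl⟩ := M.mkQ_surjective x
    rw [hg, Submodule.mkQ_apply, Submodule.Quotient.mk_eq_zero] at hx
    obtain ⟨x', hx', he⟩ := hMsurj _ hx
    rw [Submodule.mkQ_apply, Submodule.Quotient.mk_eq_zero, ← hf he]
    exact hx'
  have : Nontrivial (N ⧸ M) := Submodule.Quotient.nontrivial_iff.2 hne
  obtain ⟨r, s, wq, hr, hrs, hwq, hgw⟩ := exists_eigen hq hσ g hginj
  have hind := indep hq hσ g hr hrs hwq hgw
  obtain ⟨w0, rfl⟩ := M.mkQ_surjective wq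
  have hmem : f^[r] w0 - piL k ^ s • w0 ∈ M := by
    rw [← Submodule.Quotient.mk_eq_zero, Submodule.Quotient.mk_sub, sub_eq_zero]
    rw [hgi] at hgw
    exact hgw
  obtain ⟨c, hc, hc'⟩ := span_surj hq hσ f _ heig hMf r hr s _ hmem
  set w := w0 - c with hw
  have hfw : f^[r] w = piL k ^ s • w := by
    have h1 : f^[r] w0 = f^[r] w + f^[r] c := by rw [← iter_add, hw, sub_add_cancel]
    rw [h1] at hc'
    have h2 : piL k ^ s • w = piL k ^ s • w0 - piL k ^ s • c := by rw [hw, smul_sub]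
    rw [h2]
    have h3 : f^[r] c - piL k ^ s • c = f^[r] w + f^[r] c - piL k ^ s • w0 := hc'
    have h4 : f^[r] w = (f^[r] w + f^[r] c - piL k ^ s • w0) + piL k ^ s • w0 - f^[r] c := by abel
    rw [h4, ← h3]; abel
  have hmk : M.mkQ w = M.mkQ w0 := by
    rw [hw, map_sub, sub_eq_self, Submodule.mkQ_apply, Submodule.Quotient.mk_eq_zero]
    exact hc
  rw [← hmk] at hind hwq
  let t : ℕ × ℤ × N := (r, s, w)
  have hJ : J N (insert t S) = J N S ∪ (fun i : ℕ => (t, i)) '' {i | i < r} := by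
    ext p
    simp only [J, Set.mem_ofPred_eq, Finset.mem_insert, Set.mem_union, Set.mem_image]
    constructor
    · rintro ⟨h | h, h'⟩
      · right
        refine ⟨p.2, ?_, ?_⟩
        · rw [h] at h'; exact h'
        · rw [← h]
      · exact Or.inl ⟨h, h'⟩
    · rintro (h | ⟨i, hi, rfl⟩)
      · exact ⟨Or.inr h.1, h.2⟩
      · exact ⟨Or.inl rfl, hi⟩
  refine ⟨insert t S, ⟨?_, ?_⟩, ?_⟩
  · intro t' ht'
    rcases Finset.mem_insert.1 ht' with rfl | h
    · exact ⟨hr, hrs, hfw⟩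
    · exact hS.1 _ h
  · rw [hJ]
    refine LinearIndepOn.union_of_quotient hS.2 ?_
    have hinjt : Function.Injective (fun i : Fin r => (t, (i : ℕ))) := by
      intro i j h
      simpa [Fin.ext_iff] using h
    have hrange : (fun i : ℕ => (t, i)) '' {i | i < r} =
        Set.range (fun i : Fin r => (t, (i : ℕ))) := by
      ext p
      constructor
      · rintro ⟨i, hi, rfl⟩; exact ⟨⟨i, hi⟩, rfl⟩
      · rintro ⟨i, rfl⟩; exact ⟨i, i.2, rfl⟩
    rw [hrange, linearIndepOn_range_iff hinjt]
    have e : ((M.mkQ ∘ vec f) ∘ fun i : Fin r => (t, (i : ℕ))) =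
        fun i : Fin r => g^[(i : ℕ)] (M.mkQ w) := by
      ext i
      rw [hgi]; rfl
    rw [← hMdef, e]
    exact hind
  · refine lt_of_le_of_ne (Submodule.span_mono (Set.image_mono ?_)) ?_
    · rw [hJ]; exact Set.subset_union_left
    · intro h
      apply hwq
      rw [Submodule.mkQ_apply, Submodule.Quotient.mk_eq_zero, h]
      refine Submodule.subset_span ⟨(t, 0), ⟨Finset.mem_insert_self _ _, ?_⟩, rfl⟩
      exact hr

theorem exists_good_top (hq : 2 ≤ q)
    (hσ : ∀ (x : LaurentSeries k) (n : ℤ), (σ x).coeff n = x.coeff n ^ q)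
    (f : N →ₛₗ[(σ : LaurentSeries k →+* LaurentSeries k)] N)
    [IsAlgClosed k] [FiniteDimensional (LaurentSeries k) N]
    (hf : Function.Injective f) :
    ∃ S : Finset (ℕ × ℤ × N), Good f S ∧
      Submodule.span (LaurentSeries k) (vec f '' J N S) = ⊤ := by
  have hmax := set_has_maximal_iff_noetherian.2
    (inferInstance : IsNoetherian (LaurentSeries k) N)
    {M | ∃ S : Finset (ℕ × ℤ × N), Good f S ∧
      Submodule.span (LaurentSeries k) (vec f '' J N S) = M}
    ⟨_, ∅, ⟨by simp, by
      have : J N ∅ = ∅ := by ext p; simp [J]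
      rw [this]; exact linearIndepOn_empty _ _⟩, rfl⟩
  obtain ⟨M, ⟨S, hS, rfl⟩, hM⟩ := hmax
  refine ⟨S, hS, ?_⟩
  by_contra hne
  obtain ⟨S', hS', hlt⟩ := extend_good hq hσ f hf S hS hne
  exact hM _ ⟨S', hS', rfl⟩ hlt

theorem phiRS_sum (f : N →ₛₗ[(σ : LaurentSeries k →+* LaurentSeries k)] N)
    (r : ℕ) (hr : 1 ≤ r) (s : ℤ) (w : N) (hw : f^[r] w = piL k ^ s • w)
    (y : Fin r → LaurentSeries k) :
    ∑ i, phiRS σ r s y i • f^[(i : ℕ)] w = f (∑ i, y i • f^[(i : ℕ)] w) := by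
  obtain ⟨r, rfl⟩ : ∃ r', r = r' + 1 := ⟨r - 1, by omega⟩
  rw [map_sum, Fin.sum_univ_succ, Fin.sum_univ_castSucc, add_comm]
  simp only [f_smul, ← Function.iterate_succ_apply' f]
  congr 1
  simp only [Fin.val_last, Nat.succ_eq_add_one, hw, smul_smul]
  simp [phiRS, mul_comm, Fin.last]

theorem main_decomp (hq : 2 ≤ q)
    (hσ : ∀ (x : LaurentSeries k) (n : ℤ), (σ x).coeff n = x.coeff n ^ q)
    (f : N →ₛₗ[(σ : LaurentSeries k →+* LaurentSeries k)] N)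
    [IsAlgClosed k] [FiniteDimensional (LaurentSeries k) N]
    (hf : Function.Injective f) :
    ∃ (m : ℕ) (r : Fin m → ℕ) (s : Fin m → ℤ),
      (∀ j, 1 ≤ r j ∧ Int.gcd (r j : ℤ) (s j) = 1) ∧
      ∃ α : N ≃ₗ[LaurentSeries k] (∀ j, Fin (r j) → LaurentSeries k),
        ∀ v : N, α (f v) = fun j => phiRS σ (r j) (s j) (α v j) := by
  obtain ⟨S, hS, htop⟩ := exists_good_top hq hσ f hf
  let ε : Fin S.card ≃ S := S.equivFin.symm
  let r : Fin S.card → ℕ := fun j => (ε j : ℕ × ℤ × N).1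
  let s : Fin S.card → ℤ := fun j => (ε j : ℕ × ℤ × N).2.1
  let w : Fin S.card → N := fun j => (ε j : ℕ × ℤ × N).2.2
  have hε : ∀ j, 1 ≤ r j ∧ Int.gcd (r j : ℤ) (s j) = 1 ∧ f^[r j] (w j) = piL k ^ s j • w j :=
    fun j => hS.1 _ (ε j).2
  let ι : (Σ j, Fin (r j)) → (ℕ × ℤ × N) × ℕ := fun p => ((ε p.1 : ℕ × ℤ × N), (p.2 : ℕ))
  have hι : Function.Injective ι := by
    rintro ⟨j, i⟩ ⟨j', i'⟩ h
    simp only [ι, Prod.mk.injEq] at h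
    have hj : j = j' := ε.injective (Subtype.ext h.1)
    subst hj
    have hi : i = i' := Fin.ext h.2
    rw [hi]
  have hrange : Set.range ι = J N S := by
    ext p
    constructor
    · rintro ⟨⟨j, i⟩, rfl⟩
      exact ⟨(ε j).2, i.2⟩
    · rintro ⟨h1, h2⟩
      obtain ⟨j, hj⟩ := ε.surjective ⟨p.1, h1⟩
      have hj' : (ε j : ℕ × ℤ × N) = p.1 := by rw [hj]
      refine ⟨⟨j, ⟨p.2, ?_⟩⟩, ?_⟩
      · simp only [r]; rw [hj']; exact h2
      · simp only [ι]; rw [hj']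
  let b0 : (Σ j, Fin (r j)) → N := fun p => f^[(p.2 : ℕ)] (w p.1)
  have hb0 : b0 = vec f ∘ ι := rfl
  have hli : LinearIndependent (LaurentSeries k) b0 := by
    rw [hb0, ← linearIndepOn_range_iff hι, hrange]
    exact hS.2
  have hsp : ⊤ ≤ Submodule.span (LaurentSeries k) (Set.range b0) := by
    rw [hb0, Set.range_comp, hrange, htop]
  let b := Module.Basis.mk hli hsp
  let α : N ≃ₗ[LaurentSeries k] (∀ j, Fin (r j) → LaurentSeries k) :=
    b.equivFun.trans (LinearEquiv.piCurry (LaurentSeries k) (fun _ _ => LaurentSeries k))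
  have hα : ∀ v : N, v = ∑ j, ∑ i, α v j i • f^[(i : ℕ)] (w j) := by
    intro v
    have h1 := b.sum_equivFun v
    rw [Fintype.sum_sigma] at h1
    rw [← h1]
    refine Finset.sum_congr rfl fun j _ => Finset.sum_congr rfl fun i _ => ?_
    rw [h1]
    simp [b, α, b0, Module.Basis.mk_apply, Sigma.curry]
  have hα2 : ∀ y : (∀ j, Fin (r j) → LaurentSeries k),
      α (∑ j, ∑ i, y j i • f^[(i : ℕ)] (w j)) = y := by
    intro y
    have := hα (α.symm y)
    rw [LinearEquiv.apply_symm_apply] at this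
    rw [← this, LinearEquiv.apply_symm_apply]
  refine ⟨S.card, r, s, fun j => ⟨(hε j).1, (hε j).2.1⟩, α, fun v => ?_⟩
  rw [← hα2 (fun j => phiRS σ (r j) (s j) (α v j))]
  congr 1
  conv_lhs => rw [hα v]
  rw [map_sum]
  refine Finset.sum_congr rfl fun j _ => ?_
  exact (phiRS_sum f (r j) (hε j).1 (s j) (w j) (hε j).2.2 (α v j)).symm

end modu

end DM

theorem dieudonne_decomposition
    (p e : ℕ) [Fact p.Prime] (he : 0 < e)
    (k : Type*) [Field k] [IsAlgClosed k] [CharP k p]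
    (σ : LaurentSeries k ≃+* LaurentSeries k)
    (hσ : ∀ (x : LaurentSeries k) (n : ℤ), (σ x).coeff n = x.coeff n ^ p ^ e)
    (N : Type*) [AddCommGroup N] [Module (LaurentSeries k) N]
    [FiniteDimensional (LaurentSeries k) N]
    (φ : N → N)
    (hadd : ∀ x y, φ (x + y) = φ x + φ y)
    (hsmul : ∀ (a : LaurentSeries k) (v : N), φ (a • v) = σ a • φ v)
    (hbij : Function.Bijective φ) :
    ∃ (m : ℕ) (r : Fin m → ℕ) (s : Fin m → ℤ),
      (∀ j, 1 ≤ r j ∧ Int.gcd (r j : ℤ) (s j) = 1) ∧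
      ∃ α : N ≃ₗ[LaurentSeries k] (∀ j, Fin (r j) → LaurentSeries k),
        ∀ v : N, α (φ v) = fun j => phiRS σ (r j) (s j) (α v j) := by
  have hq : 2 ≤ p ^ e := (Fact.out : p.Prime).two_le.trans (Nat.le_self_pow (by omega) p)
  let f : N →ₛₗ[(σ : LaurentSeries k →+* LaurentSeries k)] N :=
    { toFun := φ, map_add' := hadd, map_smul' := hsmul }
  exact DM.main_decomp hq hσ f hbij.injective
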